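/- Let H be a transitive abelian subgroup of Sym_n with n > 2 and (1,2,...,n) ∉ H, and S = S_n(H). Then for each i ∈ {1,...,n}, the ideal P_i = S a_i² S is prime in S, but the union ∪_{i=1}^n P_i is not a prime ideal of S. In particular, a union of prime ideals in a noncommutative monoid need not be prime. -/

import Mathlib

/-- The word `a_{σ(1)} ⋯ a_{σ(n)}` in the free monoid on `n` generators. -/
def permWord {n : ℕ} (σ : Equiv.Perm (Fin n)) : FreeMonoid (Fin n) :=
  FreeMonoid.ofList (List.ofFn fun i => σ i)

/-- The defining relations of `S_n(H)`. -/
def snRel (n : ℕ) (H : Set (Equiv.Perm (Fin n)))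
    (a b : FreeMonoid (Fin n)) : Prop :=
  ∃ σ ∈ H, a = permWord 1 ∧ b = permWord σ

/-- The congruence generated by the relations of `S_n(H)`. -/
def snCon (n : ℕ) (H : Set (Equiv.Perm (Fin n))) : Con (FreeMonoid (Fin n)) :=
  conGen (snRel n H)

/-- The monoid `S_n(H)` presented by `a_1,…,a_n` with relations
`a_1⋯a_n = a_{σ(1)}⋯a_{σ(n)}` for `σ ∈ H`. -/
abbrev SnMonoid (n : ℕ) (H : Set (Equiv.Perm (Fin n))) : Type :=
  (snCon n H).Quotient

/-- The canonical projection `π : FM_n → S_n(H)`. -/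
def snPi (n : ℕ) (H : Set (Equiv.Perm (Fin n))) :
    FreeMonoid (Fin n) →* SnMonoid n H :=
  (snCon n H).mk'

/-- The generator `a_i` of `S_n(H)`. -/
def aGen (n : ℕ) (H : Set (Equiv.Perm (Fin n))) (i : Fin n) : SnMonoid n H :=
  snPi n H (FreeMonoid.of i)

/-- The element `z = a_1 a_2 ⋯ a_n` of `S_n(H)`. -/
def zElem (n : ℕ) (H : Set (Equiv.Perm (Fin n))) : SnMonoid n H :=
  snPi n H (permWord 1)

/-- A (two-sided) ideal-like subset `I` of a monoid is prime if for all `u, v ∉ I`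
there is `s` with `u * s * v ∉ I`. -/
def MonoidIdeal.IsPrime {M : Type*} [Monoid M] (I : Set M) : Prop :=
  ∀ u v : M, u ∉ I → v ∉ I → ∃ s : M, u * s * v ∉ I


namespace SnAux

abbrev w {n : ℕ} (σ : Equiv.Perm (Fin n)) : List (Fin n) := List.ofFn fun i => σ i

/-- One rewriting step. -/
def Step {n : ℕ} (H : Subgroup (Equiv.Perm (Fin n))) (V V' : List (Fin n)) : Prop :=
  ∃ A B : List (Fin n), ∃ σ ∈ H, ∃ τ ∈ H, V = A ++ (w σ ++ B) ∧ V' = A ++ (w τ ++ B)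

abbrev Eqv {n : ℕ} (H : Subgroup (Equiv.Perm (Fin n))) := Relation.ReflTransGen (Step H)

def InQ {n : ℕ} (H : Subgroup (Equiv.Perm (Fin n))) (q : List (Fin n)) : Prop :=
  ∃ s p : List (Fin n), ∃ σ ∈ H, ∃ ρ ∈ H, s ++ q = w σ ∧ p ++ s = w ρ

def InQS {n : ℕ} (H : Subgroup (Equiv.Perm (Fin n))) (Y : List (Fin n)) : Prop :=
  ∃ ys : List (List (Fin n)), (∀ y ∈ ys, InQ H y) ∧ Y = ys.flatten

def InT {n : ℕ} (H : Subgroup (Equiv.Perm (Fin n))) (V : List (Fin n)) : Prop :=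
  ∃ A Y : List (Fin n), ∃ ρ ∈ H, InQS H Y ∧ V = A ++ (w ρ ++ Y)

variable {n : ℕ} {H : Subgroup (Equiv.Perm (Fin n))}

lemma eqv_symm {a b : List (Fin n)} (h : Eqv H a b) : Eqv H b a := by
  induction h with
  | refl => exact .refl
  | tail _ hs ih =>
    obtain ⟨A, B, σ, hσ, τ, hτ, h1, h2⟩ := hs
    exact Relation.ReflTransGen.head ⟨A, B, τ, hτ, σ, hσ, h2, h1⟩ ih

lemma eqv_lift {H' : Subgroup (Equiv.Perm (Fin n))} (f : List (Fin n) → List (Fin n))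
    (hf : ∀ x y, Step H x y → Step H' (f x) (f y)) {a b : List (Fin n)} (h : Eqv H a b) :
    Eqv H' (f a) (f b) := by
  induction h with
  | refl => exact .refl
  | tail _ hs ih => exact ih.tail (hf _ _ hs)

lemma w_len (σ : Equiv.Perm (Fin n)) : (w σ).length = n := by simp

lemma w_nodup (σ : Equiv.Perm (Fin n)) : (w σ).Nodup := by
  rw [List.nodup_ofFn]; exact σ.injective

lemma getL {x y : List (Fin n)} {σ : Equiv.Perm (Fin n)} (h : x ++ y = w σ) (j : ℕ)
    (hj : j < x.length) (hn : j < n) : x[j]? = some (σ ⟨j, hn⟩) := by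
  have := congrArg (fun l => l[j]?) h
  simpa [List.getElem?_append, hj, hn] using this

lemma getR {x y : List (Fin n)} {σ : Equiv.Perm (Fin n)} (h : x ++ y = w σ) (j : ℕ)
    (hn : x.length + j < n) : y[j]? = some (σ ⟨x.length + j, hn⟩) := by
  have := congrArg (fun l => l[x.length + j]?) h
  simpa [List.getElem?_append, hn] using this

lemma lenE {x y : List (Fin n)} {σ : Equiv.Perm (Fin n)} (h : x ++ y = w σ) :
    x.length + y.length = n := by
  have := congrArg List.length h
  simpa using this

lemma regular (hab : ∀ σ ∈ H, ∀ τ ∈ H, σ * τ = τ * σ)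
    (htrans : ∀ i j : Fin n, ∃ σ ∈ H, σ i = j) {σ τ : Equiv.Perm (Fin n)}
    (hσ : σ ∈ H) (hτ : τ ∈ H) (x : Fin n) (h : σ x = τ x) : σ = τ := by
  ext1 y
  obtain ⟨ρ, hρ, rfl⟩ := htrans x y
  have h1 := congrArg (fun f => f x) (hab σ hσ ρ hρ)
  have h2 := congrArg (fun f => f x) (hab τ hτ ρ hρ)
  simp only [Equiv.Perm.mul_apply] at h1 h2
  rw [h1, h2, h]

lemma commA (hab : ∀ σ ∈ H, ∀ τ ∈ H, σ * τ = τ * σ) {σ τ : Equiv.Perm (Fin n)}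
    (hσ : σ ∈ H) (hτ : τ ∈ H) (x : Fin n) : σ (τ x) = τ (σ x) := by
  have h1 := congrArg (fun f => f x) (hab σ hσ τ hτ)
  simpa only [Equiv.Perm.mul_apply] using h1

/-- The partial translation attached to an element of `Q`. -/
lemma shift {q : List (Fin n)} (hq : InQ H q) :
    ∃ g ∈ H, ∀ j (h : j + q.length < n), g ⟨j, by omega⟩ = ⟨j + q.length, h⟩ := by
  obtain ⟨s, p, σ, hσ, ρ, hρ, h1, h2⟩ := hq
  have l1 := lenE h1
  have l2 := lenE h2
  refine ⟨ρ⁻¹ * σ, H.mul_mem (H.inv_mem hρ) hσ, fun j h => ?_⟩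
  have e1 := getL h1 j (by omega) (by omega)
  have e2 := getR h2 j (by omega)
  rw [e1] at e2
  rw [Equiv.Perm.mul_apply, Equiv.Perm.inv_eq_iff_eq, Option.some.inj e2]
  congr 2
  omega

lemma inQ_nil : InQ H [] := ⟨w 1, [], 1, H.one_mem, 1, H.one_mem, by simp, by simp⟩

lemma inQ_w {σ : Equiv.Perm (Fin n)} (hσ : σ ∈ H) : InQ H (w σ) :=
  ⟨[], w 1, σ, hσ, 1, H.one_mem, by simp, by simp⟩

lemma lemma1 (hab : ∀ σ ∈ H, ∀ τ ∈ H, σ * τ = τ * σ)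
    (htrans : ∀ i j : Fin n, ∃ σ ∈ H, σ i = j) {y r : List (Fin n)}
    (hy : InQ H y) (hq : InQ H (y ++ r)) : InQ H r := by
  by_cases hy0 : y = []
  · subst hy0; simpa using hq
  have hd : 0 < y.length := List.length_pos_iff.mpr hy0
  obtain ⟨gd, hgd, Hgd⟩ := shift hy
  obtain ⟨gl, hgl, Hgl⟩ := shift hq
  obtain ⟨s, p, σ, hσ, ρ, hρ, h1, h2⟩ := hq
  obtain ⟨s', p', τ, hτ, ρ', hρ', h1', h2'⟩ := hy
  have l1 := lenE h1
  have l1' := lenE h1'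
  simp only [List.length_append] at l1 Hgl
  refine ⟨s ++ y, (w τ).take r.length, σ, hσ, τ, hτ, by simpa using h1, ?_⟩
  have key : s ++ y = (w τ).drop r.length := by
    have hyt : ∀ j (hj : j < y.length), τ ⟨s'.length + j, by omega⟩ = σ ⟨s.length + j, by omega⟩ := by
      intro j hj
      have e1 := getR h1' j (by omega)
      have e2 := getR h1 j (by omega)
      rw [List.getElem?_append_left hj, e1] at e2
      exact Option.some.inj e2
    have hs : ∀ j (hj : j < s.length), τ ⟨r.length + j, by omega⟩ = σ ⟨j, by omega⟩ := by
      have heH : τ⁻¹ * σ ∈ H := H.mul_mem (H.inv_mem hτ) hσ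
      intro m hm
      have E : (τ⁻¹ * σ) * gd = gl := by
        refine regular hab htrans (H.mul_mem heH hgd) hgl ⟨s.length - 1, by omega⟩ ?_
        rw [Equiv.Perm.mul_apply, Hgd _ (by omega), Hgl _ (by omega), Equiv.Perm.mul_apply,
          Equiv.Perm.inv_eq_iff_eq]
        have := hyt (y.length - 1) (by omega)
        convert this.symm using 3 <;> omega
      have E2 := congrArg (fun f => f ⟨m, by omega⟩) E
      simp only [Equiv.Perm.mul_apply] at E2
      rw [Hgl m (by omega)] at E2
      have E3 := commA hab heH hgd ⟨m, by omega⟩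
      simp only [Equiv.Perm.mul_apply] at E3
      rw [E3] at E2
      have E4 := Hgd (r.length + m) (by omega)
      have E5 : (τ⁻¹ (σ ⟨m, by omega⟩)) = ⟨r.length + m, by omega⟩ := by
        apply gd.injective
        rw [E2, E4]
        congr 1
        omega
      rw [Equiv.Perm.inv_eq_iff_eq] at E5
      exact E5.symm
    apply List.ext_getElem?
    intro j
    rw [List.getElem?_drop]
    by_cases hj : j < s.length
    · rw [List.getElem?_append_left hj, getL h1 j hj (by omega)]
      rw [List.getElem?_eq_getElem (by simp; omega)]
      simp [hs j hj]
    · by_cases hj2 : j < s.length + y.length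
      · rw [List.getElem?_append_right (by omega), getR h1' _ (by omega)]
        rw [List.getElem?_eq_getElem (by simp; omega)]
        simp only [List.getElem_ofFn]
        congr 3
        omega
      · rw [List.getElem?_eq_none (by simp; omega), List.getElem?_eq_none (by simp; omega)]
  rw [key, List.take_append_drop]

lemma inQS_cons {y Y : List (Fin n)} (hy : InQ H y) (hY : InQS H Y) : InQS H (y ++ Y) := by
  obtain ⟨ys, h, rfl⟩ := hY
  exact ⟨y :: ys, by simpa using ⟨hy, h⟩, by simp⟩

lemma lemma3 (hab : ∀ σ ∈ H, ∀ τ ∈ H, σ * τ = τ * σ)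
    (htrans : ∀ i j : Fin n, ∃ σ ∈ H, σ i = j) (ys : List (List (Fin n))) :
    ∀ (_ : ∀ y ∈ ys, InQ H y) (q Y' : List (Fin n)) (_ : InQ H q) (_ : ys.flatten = q ++ Y'),
      InQS H Y' := by
  induction ys with
  | nil =>
    intro _ q Y' _ h
    have : Y' = [] := by
      have h' := h.symm
      simp only [List.flatten_nil, List.append_eq_nil_iff] at h'
      exact h'.2
    exact ⟨[], by simp, by simp [this]⟩
  | cons y rest ih =>
    intro hys q Y' hq h
    have hy : InQ H y := hys y (by simp)
    have hr : ∀ y ∈ rest, InQ H y := fun z hz => hys z (by simp [hz])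
    rw [List.flatten_cons, List.append_eq_append_iff] at h
    rcases h with ⟨r, hr1, hr2⟩ | ⟨r, hr1, hr2⟩
    · subst hr1
      exact ih hr r Y' (lemma1 hab htrans hy hq) hr2
    · subst hr1
      rw [hr2]
      exact inQS_cons (lemma1 hab htrans hq hy) ⟨rest, hr, rfl⟩

lemma lemma4 (hn : 0 < n) (hab : ∀ σ ∈ H, ∀ τ ∈ H, σ * τ = τ * σ)
    (htrans : ∀ i j : Fin n, ∃ σ ∈ H, σ i = j) {σ : Equiv.Perm (Fin n)} (hσ : σ ∈ H)
    (ys : List (List (Fin n))) :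
    ∀ (_ : ∀ y ∈ ys, InQ H y) (Y1 Y2 : List (Fin n)) (_ : ys.flatten = Y1 ++ (w σ ++ Y2)),
      InQS H Y2 := by
  induction ys with
  | nil =>
    intro _ Y1 Y2 h
    have := congrArg List.length h
    simp at this
    omega
  | cons y rest ih =>
    intro hys Y1 Y2 h
    have hy : InQ H y := hys y (by simp)
    have hr : ∀ y ∈ rest, InQ H y := fun z hz => hys z (by simp [hz])
    rw [List.flatten_cons, List.append_eq_append_iff] at h
    rcases h with ⟨c, h1, h2⟩ | ⟨c, h1, h2⟩
    · exact ih hr c Y2 h2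
    · obtain ⟨s, p, τ, hτ, ρ, hρ, e1, e2⟩ := hy
      rw [List.append_eq_append_iff] at h2
      rcases h2 with ⟨b, k1, k2⟩ | ⟨b, k1, k2⟩
      · have l := lenE e1
        rw [h1, k1] at l
        simp at l
        have : b = [] := List.length_eq_zero_iff.mp (by omega)
        subst this
        exact ⟨rest, hr, by simpa using k2⟩
      · refine lemma3 hab htrans rest hr b Y2 ⟨c, s ++ Y1, σ, hσ, τ, hτ, k1.symm, ?_⟩ k2
        rw [← e1, h1]; simp

lemma lemma5 (hn : 0 < n) (hab : ∀ σ ∈ H, ∀ τ ∈ H, σ * τ = τ * σ)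
    (htrans : ∀ i j : Fin n, ∃ σ ∈ H, σ i = j) {V V' : List (Fin n)} (hV : InT H V)
    (hs : Step H V V') : InT H V' := by
  obtain ⟨A, Y, ρ, hρ, hY, rfl⟩ := hV
  obtain ⟨B, C, σ, hσ, τ, hτ, h, rfl⟩ := hs
  rw [List.append_eq_append_iff] at h
  rcases h with ⟨c, h1, h2⟩ | ⟨c, h1, h2⟩
  · obtain ⟨ys, hys, e⟩ := inQS_cons (inQ_w hρ) hY
    exact ⟨B, C, τ, hτ, lemma4 hn hab htrans hσ ys hys c C (by rw [← e, h2]), rfl⟩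
  · rw [List.append_eq_append_iff] at h2
    rcases h2 with ⟨b, k1, k2⟩ | ⟨b, k1, k2⟩
    · refine ⟨B ++ (w τ ++ b), Y, ρ, hρ, hY, ?_⟩
      rw [k2]; simp
    · rw [List.append_eq_append_iff] at k2
      rcases k2 with ⟨d, m1, m2⟩ | ⟨d, m1, m2⟩
      · have l := lenE k1.symm
        rw [m1] at l
        simp at l
        have : d = [] := List.length_eq_zero_iff.mp (by omega)
        subst this
        refine ⟨B, C, τ, hτ, ?_, rfl⟩
        simp at m2
        exact m2 ▸ hY
      · refine ⟨B, C, τ, hτ, ?_, rfl⟩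
        rw [m2]
        exact inQS_cons ⟨b, c, ρ, hρ, σ, hσ, m1.symm, k1.symm⟩ hY

/-- last nonempty factor -/
lemma lastFactor (ys : List (List (Fin n))) (hys : ∀ y ∈ ys, InQ H y) (h : ys.flatten ≠ []) :
    ∃ X y, ys.flatten = X ++ y ∧ InQ H y ∧ y ≠ [] := by
  induction ys with
  | nil => simp at h
  | cons y rest ih =>
    by_cases hr : rest.flatten = []
    · refine ⟨[], y, by simp [hr], hys y (by simp), ?_⟩
      rintro rfl
      simp [hr] at h
    · obtain ⟨X, z, h1, h2, h3⟩ := ih (fun z hz => hys z (by simp [hz])) hr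
      exact ⟨y ++ X, z, by simp [h1], h2, h3⟩

lemma lemma6 (hn : 2 < n) (hab : ∀ σ ∈ H, ∀ τ ∈ H, σ * τ = τ * σ)
    (hrot : finRotate n ∉ H) {V : List (Fin n)} (hV : InT H V) {σ : Equiv.Perm (Fin n)}
    (hσ : σ ∈ H) (B : List (Fin n)) (j : Fin n) (h : V ++ [j] = B ++ w σ) : False := by
  obtain ⟨A, Y, ρ, hρ, hY, rfl⟩ := hV
  obtain ⟨ys, hys, e⟩ := inQS_cons (inQ_w hρ) hY
  obtain ⟨X, y, h1, h2, h3⟩ := lastFactor ys hys (by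
    rw [← e]; intro h0
    have := congrArg List.length h0
    simp at this; omega)
  obtain ⟨g, hg, Hg⟩ := shift h2
  obtain ⟨s, p, τ, hτ, ρ', hρ', e1, e2⟩ := h2
  have hd : 0 < y.length := List.length_pos_iff.mpr h3
  have l1 := lenE e1
  rw [e, h1] at h
  have hl := congrArg List.length h
  simp at hl
  have hh : ∀ m (hm : m + 1 < n), n ≤ m + 1 + y.length →
      τ ⟨m + 1, hm⟩ = σ ⟨m, by omega⟩ := by
    intro m hm hm2
    have e3 := getR e1 (m + 1 - s.length) (by omega)
    have e4 := congrArg (fun l => l[B.length + m]?) h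
    beta_reduce at e4
    rw [List.getElem?_append_right (l₁ := B) (by omega), List.getElem?_append_left (by simp; omega),
      ← List.append_assoc, List.getElem?_append_right (by simp; omega)] at e4
    have : B.length + m - (A ++ X).length = m + 1 - s.length := by simp; omega
    rw [this, e3, List.getElem?_eq_getElem (by simp; omega)] at e4
    simp only [List.getElem_ofFn, Option.some.injEq] at e4
    convert e4 using 3 <;> omega
  have heH : σ⁻¹ * τ ∈ H := H.mul_mem (H.inv_mem hσ) hτ
  have all : ∀ k m (hm : m + 1 < n), n ≤ m + 1 + k →
      (σ⁻¹ * τ) ⟨m + 1, hm⟩ = ⟨m, by omega⟩ := by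
    intro k
    induction k with
    | zero => intro m hm hk; omega
    | succ k ih =>
      intro m hm hk
      by_cases hc : n ≤ m + 1 + y.length
      · rw [Equiv.Perm.mul_apply, Equiv.Perm.inv_eq_iff_eq, hh m hm hc]
      · apply g.injective
        rw [← commA hab heH hg, Hg (m + 1) (by omega), Hg m (by omega)]
        have := ih (m + y.length) (by omega) (by omega)
        convert this using 3
        omega
  apply hrot
  have : finRotate n = (σ⁻¹ * τ)⁻¹ := by
    obtain ⟨N, rfl⟩ : ∃ N, n = N + 1 := ⟨n - 1, by omega⟩
    have aux : ∀ x : Fin (N + 1), x ≠ Fin.last N → finRotate (N + 1) x = (σ⁻¹ * τ)⁻¹ x := by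
      intro x hx
      have hx' : x.val < N := by
        have := Fin.val_ne_of_ne hx
        simp at this
        omega
      rw [Equiv.Perm.eq_inv_iff_eq, finRotate_of_lt hx']
      exact all (N + 1) x.val (by omega) (by omega)
    ext1 x
    by_cases hx : x = Fin.last N
    · subst hx
      have hs : (finRotate (N + 1)) ((finRotate (N + 1)).symm ((σ⁻¹ * τ)⁻¹ (Fin.last N))) =
        (σ⁻¹ * τ)⁻¹ (Fin.last N) := Equiv.apply_symm_apply _ _
      by_cases h5 : (finRotate (N + 1)).symm ((σ⁻¹ * τ)⁻¹ (Fin.last N)) = Fin.last N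
      · rw [h5] at hs; exact hs
      · rw [aux _ h5] at hs
        exact absurd ((σ⁻¹ * τ)⁻¹.injective hs) h5
    · exact aux x hx
  rw [this]
  exact H.inv_mem heH

lemma goodR (hn : 2 < n) (hab : ∀ σ ∈ H, ∀ τ ∈ H, σ * τ = τ * σ)
    (htrans : ∀ i j : Fin n, ∃ σ ∈ H, σ i = j) (hrot : finRotate n ∉ H)
    (U : List (Fin n)) (i : Fin n) :
    ∃ j, j ≠ i ∧ ∀ V, Eqv H U V → ∀ σ ∈ H, ∀ B, V ++ [j] ≠ B ++ w σ := by
  have hcard : 2 < Fintype.card (Fin n) := by simpa using hn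
  by_cases hz : ∃ X, ∃ σ ∈ H, Eqv H U (X ++ w σ)
  · obtain ⟨X, σ, hσ, hX⟩ := hz
    have : Nontrivial (Fin n) := Fintype.one_lt_card_iff_nontrivial.mp (by omega)
    obtain ⟨j, hj⟩ := exists_ne i
    refine ⟨j, hj, fun V hV τ hτ B hB => ?_⟩
    have hXV : Eqv H (X ++ w σ) V := (eqv_symm hX).trans hV
    have hT : InT H V := by
      clear hB hV
      induction hXV with
      | refl => exact ⟨X, [], σ, hσ, ⟨[], by simp, by simp⟩, by simp⟩
      | tail _ hs ih => exact lemma5 (by omega) hab htrans ih hs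
    exact lemma6 hn hab hrot hT hτ B j hB
  · push Not at hz
    have hlast : ∀ V, Eqv H U V → V.getLast? = U.getLast? := by
      intro V hV
      induction hV with
      | refl => rfl
      | tail h1 hs ih =>
        obtain ⟨A, B, σ, hσ, τ, hτ, rfl, rfl⟩ := hs
        rw [← ih]
        have hB : B ≠ [] := by
          rintro rfl
          exact hz A σ hσ (by simpa using h1)
        obtain ⟨B', b, rfl⟩ := List.eq_nil_or_concat B |>.resolve_left hB
        simp [← List.append_assoc]
    have huniq : ∀ j, (∃ V, Eqv H U V ∧ ∃ σ ∈ H, ∃ B, V ++ [j] = B ++ w σ) →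
        ∃ σ ∈ H, U.getLast? = some (σ ⟨n - 2, by omega⟩) ∧ j = σ ⟨n - 1, by omega⟩ := by
      rintro j ⟨V, hV, σ, hσ, B, hB⟩
      refine ⟨σ, hσ, ?_, ?_⟩
      · rw [← hlast V hV, List.getLast?_eq_getElem?]
        have hl := congrArg List.length hB
        simp at hl
        have e := congrArg (fun l => l[V.length - 1]?) hB
        beta_reduce at e
        rw [List.getElem?_append_left (by omega), List.getElem?_append_right (by omega)] at e
        rw [e, List.getElem?_eq_getElem (by simp; omega)]
        simp only [List.getElem_ofFn]
        congr 3
        omega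
      · have hl := congrArg List.length hB
        simp at hl
        have e := congrArg (fun l => l[V.length]?) hB
        beta_reduce at e
        rw [List.getElem?_append_right (l₁ := V) (by omega),
          List.getElem?_append_right (by omega)] at e
        rw [List.getElem?_eq_getElem (l := w σ) (by simp; omega)] at e
        simp only [List.getElem_ofFn, Nat.sub_self, List.getElem?_cons_zero,
          Option.some.injEq] at e
        rw [e]
        congr 2
        omega
    by_contra hcon
    push Not at hcon
    obtain ⟨a, ha⟩ : ∃ a, a ∉ ({i} : Finset (Fin n)) := by
      by_contra hh
      push Not at hh
      have := Finset.card_le_card (fun x _ => hh x : Finset.univ ⊆ ({i} : Finset (Fin n)))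
      simp at this
      omega
    obtain ⟨b, hb⟩ : ∃ b, b ∉ ({i, a} : Finset (Fin n)) := by
      by_contra hh
      push Not at hh
      have := Finset.card_le_card (fun x _ => hh x : Finset.univ ⊆ ({i, a} : Finset (Fin n)))
      have h2 := Finset.card_le_two (a := i) (b := a)
      simp only [Finset.card_univ] at this
      omega
    simp at ha hb
    obtain ⟨V1, hV1, σ1, hσ1, B1, hB1⟩ := hcon a ha
    obtain ⟨V2, hV2, σ2, hσ2, B2, hB2⟩ := hcon b hb.1
    obtain ⟨τ1, k1, k2, k3⟩ := huniq a ⟨V1, hV1, σ1, hσ1, B1, hB1⟩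
    obtain ⟨τ2, m1, m2, m3⟩ := huniq b ⟨V2, hV2, σ2, hσ2, B2, hB2⟩
    rw [k2] at m2
    have := regular hab htrans k1 m1 _ (Option.some.inj m2)
    subst this
    exact hb.2 (m3.trans k3.symm)

/-- Conjugated subgroup, for the left-right symmetry. -/
def conjH (H : Subgroup (Equiv.Perm (Fin n))) : Subgroup (Equiv.Perm (Fin n)) :=
  H.map (MulAut.conj (Fin.revPerm : Equiv.Perm (Fin n))).toMonoidHom

def flip (V : List (Fin n)) : List (Fin n) := (V.map Fin.rev).reverse

lemma flip_append (A B : List (Fin n)) : flip (A ++ B) = flip B ++ flip A := by simp [flip]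

lemma flip_flip (A : List (Fin n)) : flip (flip A) = A := by
  simp [flip, Function.comp_def]

def cj (σ : Equiv.Perm (Fin n)) : Equiv.Perm (Fin n) := Fin.revPerm * σ * Fin.revPerm⁻¹

lemma cj_mem {σ : Equiv.Perm (Fin n)} (h : σ ∈ H) : cj σ ∈ conjH H :=
  ⟨σ, h, by simp [cj]⟩

lemma cj_apply (σ : Equiv.Perm (Fin n)) (x : Fin n) : cj σ x = (σ x.rev).rev := by
  simp [cj, Equiv.Perm.inv_def]

lemma mem_conj {σ : Equiv.Perm (Fin n)} (h : σ ∈ conjH H) : ∃ τ ∈ H, σ = cj τ := by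
  obtain ⟨τ, h1, h2⟩ := h
  exact ⟨τ, h1, by rw [← h2]; simp [cj]⟩

lemma flip_w (σ : Equiv.Perm (Fin n)) : flip (w σ) = w (cj σ) := by
  apply List.ext_getElem
  · simp [flip]
  · intro k h1 h2
    simp [flip, cj_apply, Fin.rev]
    congr 4
    rw [Fin.mk.injEq]
    omega

lemma flip_step {V V' : List (Fin n)} (h : Step H V V') : Step (conjH H) (flip V) (flip V') := by
  obtain ⟨A, B, σ, hσ, τ, hτ, rfl, rfl⟩ := h
  exact ⟨flip B, flip A, cj σ, cj_mem hσ, cj τ, cj_mem hτ, by simp only [flip_append, flip_w, List.append_assoc],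
    by simp only [flip_append, flip_w, List.append_assoc]⟩

lemma flip_eqv {V V' : List (Fin n)} (h : Eqv H V V') : Eqv (conjH H) (flip V) (flip V') :=
  eqv_lift flip (fun _ _ h => flip_step h) h

lemma goodL (hn : 2 < n) (hab : ∀ σ ∈ H, ∀ τ ∈ H, σ * τ = τ * σ)
    (htrans : ∀ i j : Fin n, ∃ σ ∈ H, σ i = j) (hrot : finRotate n ∉ H)
    (U : List (Fin n)) (i : Fin n) :
    ∃ j, j ≠ i ∧ ∀ V, Eqv H U V → ∀ σ ∈ H, ∀ B, [j] ++ V ≠ w σ ++ B := by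
  obtain ⟨j, hj, h⟩ := goodR (H := conjH H) hn (by
      intro σ hσ τ hτ
      obtain ⟨σ, h1, rfl⟩ := mem_conj hσ
      obtain ⟨τ, h2, rfl⟩ := mem_conj hτ
      ext1 x
      simp [cj_apply, commA hab h1 h2]) (by
      intro a b
      obtain ⟨σ, h1, h2⟩ := htrans a.rev b.rev
      exact ⟨cj σ, cj_mem h1, by rw [cj_apply, h2, Fin.rev_rev]⟩) (by
      intro hr
      obtain ⟨τ, h1, h2⟩ := mem_conj hr
      apply hrot
      have : finRotate n = τ⁻¹ := by
        obtain ⟨N, rfl⟩ : ∃ N, n = N + 1 := ⟨n - 1, by omega⟩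
        ext1 x
        rw [Equiv.Perm.eq_inv_iff_eq]
        have h3 := congrArg (fun f => f (x + 1).rev) h2
        simp only [cj_apply, Fin.rev_rev, finRotate_apply] at h3
        rw [finRotate_apply]
        have h4 := congrArg Fin.rev h3
        rw [Fin.rev_rev] at h4
        rw [← h4]
        rw [Fin.rev_eq_iff]
        rw [Fin.rev_add, sub_add_cancel]
      rw [this]
      exact H.inv_mem h1) (flip U) i.rev
  refine ⟨j.rev, fun h0 => hj (by rw [← h0, Fin.rev_rev]), fun V hV σ hσ B hB => ?_⟩
  apply h _ (flip_eqv hV) (cj σ) (cj_mem hσ) (flip B)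
  have := congrArg flip hB
  rw [flip_append, flip_append, flip_w] at this
  rw [← this]
  simp [flip]

lemma insulated (hn : 2 < n) {U V : List (Fin n)} {j l : Fin n}
    (hj : ∀ U', Eqv H U U' → ∀ σ ∈ H, ∀ B, U' ++ [j] ≠ B ++ w σ)
    (hl : ∀ V', Eqv H V V' → ∀ σ ∈ H, ∀ B, [l] ++ V' ≠ w σ ++ B)
    {X : List (Fin n)} (hX : Eqv H (U ++ ([j, j, l, l] ++ V)) X) :
    ∃ U' V', Eqv H U U' ∧ Eqv H V V' ∧ X = U' ++ ([j, j, l, l] ++ V') := by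
  induction hX with
  | refl => exact ⟨U, V, .refl, .refl, rfl⟩
  | tail _ hs ih =>
    obtain ⟨U', V', hU, hV, rfl⟩ := ih
    obtain ⟨A, B, σ, hσ, τ, hτ, h, rfl⟩ := hs
    have hnd := w_nodup σ
    have hlen := w_len σ
    have two : ∀ {a b : Fin n} {R : List (Fin n)}, a :: b :: b :: R ≠ w σ ++ B := by
      intro a b R h0
      have e1 := congrArg (fun l => l[1]?) h0
      have e2 := congrArg (fun l => l[2]?) h0
      beta_reduce at e1 e2
      rw [List.getElem?_append_left (by omega)] at e1 e2
      simp at e1 e2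
      obtain ⟨_, e1⟩ := e1
      obtain ⟨_, e2⟩ := e2
      have := σ.injective (e1.symm.trans e2)
      simp at this
    have one : ∀ {b : Fin n} {R : List (Fin n)}, b :: b :: R ≠ w σ ++ B := by
      intro b R h0
      have e1 := congrArg (fun l => l[0]?) h0
      have e2 := congrArg (fun l => l[1]?) h0
      beta_reduce at e1 e2
      rw [List.getElem?_append_left (by omega)] at e1 e2
      simp at e1 e2
      obtain ⟨_, e1⟩ := e1
      obtain ⟨_, e2⟩ := e2
      have := σ.injective (e1.symm.trans e2)
      simp at this
    have h' : (U' ++ [j]) ++ (j :: l :: l :: V') = A ++ (w σ ++ B) := by simpa using h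
    rw [List.append_eq_append_iff] at h'
    rcases h' with ⟨c, h1, h2⟩ | ⟨c, h1, h2⟩
    · rcases c with _ | ⟨c1, c⟩
      · exact absurd h2 two
      simp only [List.cons_append, List.cons.injEq] at h2
      obtain ⟨rfl, h2⟩ := h2
      rcases c with _ | ⟨c2, c⟩
      · exact absurd h2 one
      simp only [List.cons_append, List.cons.injEq] at h2
      obtain ⟨rfl, h2⟩ := h2
      rcases c with _ | ⟨c3, c⟩
      · exact absurd h2 (hl V' hV σ hσ B)
      simp only [List.cons_append, List.cons.injEq] at h2
      obtain ⟨rfl, h2⟩ := h2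
      refine ⟨U', c ++ (w τ ++ B), hU, hV.tail ⟨c, B, σ, hσ, τ, hτ, h2, rfl⟩, ?_⟩
      rw [h1]; simp
    · rw [List.append_eq_append_iff] at h2
      rcases h2 with ⟨b, k1, k2⟩ | ⟨b, k1, k2⟩
      · rcases List.eq_nil_or_concat b with rfl | ⟨b', x, rfl⟩
        · simp only [List.append_nil] at k1
          subst k1
          exact absurd h1 (hj U' hU σ hσ A)
        · rw [k1, List.concat_eq_append, ← List.append_assoc, ← List.append_assoc] at h1
          obtain ⟨h3, h4⟩ := List.append_inj' h1 rfl
          obtain rfl : j = x := by simpa using h4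
          refine ⟨A ++ (w τ ++ b'), V', hU.tail ⟨A, b', σ, hσ, τ, hτ, by rw [h3]; simp, rfl⟩, hV, ?_⟩
          rw [k2]; simp
      · rcases b with _ | ⟨b1, b⟩
        · simp only [List.append_nil] at k1
          subst k1
          exact absurd h1 (hj U' hU σ hσ A)
        · simp only [List.cons_append, List.cons.injEq] at k2
          obtain ⟨rfl, k2⟩ := k2
          rcases List.eq_nil_or_concat c with rfl | ⟨c', x, rfl⟩
          · simp only [List.nil_append] at k1
            refine absurd ?_ (two (a := j) (b := l) (R := V'))
            rw [k1, k2]; simp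
          · rw [List.concat_eq_append, ← List.append_assoc] at h1
            obtain ⟨h3, h4⟩ := List.append_inj' h1 rfl
            obtain rfl : j = x := by simpa using h4
            rw [k1] at hnd
            simp [List.nodup_append] at hnd

lemma chain_iff (i : Fin n) (X : List (Fin n)) :
    X.IsChain (fun a b => ¬ (a = i ∧ b = i)) ↔ ∀ S T, X ≠ S ++ ([i, i] ++ T) := by
  constructor
  · rintro h S T rfl
    simp [List.isChain_append] at h
  · intro h
    induction X with
    | nil => simp
    | cons a X ih =>
      cases X with
      | nil => simp
      | cons b X =>
        rw [List.isChain_cons_cons]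
        refine ⟨?_, ih fun S T e => h (a :: S) T (by rw [e]; rfl)⟩
        rintro ⟨rfl, rfl⟩
        exact h [] X rfl

def stepCon (H : Subgroup (Equiv.Perm (Fin n))) : Con (FreeMonoid (Fin n)) where
  r a b := Eqv H a.toList b.toList
  iseqv := by
    exact ⟨fun _ => .refl, fun h => eqv_symm h, fun h h' => h.trans h'⟩
  mul' := by
    intro a b c d h1 h2
    rw [FreeMonoid.toList_mul, FreeMonoid.toList_mul]
    have e1 : Eqv H (a.toList ++ c.toList) (b.toList ++ c.toList) := by
      refine eqv_lift (fun l => l ++ c.toList) ?_ h1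
      rintro _ _ ⟨A, B, σ, hσ, τ, hτ, rfl, rfl⟩
      exact ⟨A, B ++ c.toList, σ, hσ, τ, hτ, by simp, by simp⟩
    refine e1.trans ?_
    refine eqv_lift (fun l => b.toList ++ l) ?_ h2
    rintro _ _ ⟨A, B, σ, hσ, τ, hτ, rfl, rfl⟩
    exact ⟨b.toList ++ A, B, σ, hσ, τ, hτ, by simp, by simp⟩

/-- class of a list -/
def cl (H : Subgroup (Equiv.Perm (Fin n))) (X : List (Fin n)) : SnMonoid n ↑H :=
  snPi n ↑H (FreeMonoid.ofList X)

lemma cl_append (X Y : List (Fin n)) : cl H (X ++ Y) = cl H X * cl H Y := by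
  rw [cl, FreeMonoid.ofList_append, map_mul]; rfl

lemma cl_surj (x : SnMonoid n ↑H) : ∃ X, cl H X = x := by
  obtain ⟨a, rfl⟩ := Con.mk'_surjective (c := snCon n ↑H) x
  exact ⟨a.toList, rfl⟩

lemma cl_gen (i : Fin n) : cl H [i] = aGen n ↑H i := rfl

lemma cl_w {σ : Equiv.Perm (Fin n)} (hσ : σ ∈ H) : cl H (w σ) = zElem n ↑H := by
  symm
  exact (Con.eq _).mpr (ConGen.Rel.of _ _ ⟨σ, hσ, rfl, rfl⟩)

lemma cl_eq {X Y : List (Fin n)} : cl H X = cl H Y ↔ Eqv H X Y := by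
  constructor
  · intro h
    have h1 : snCon n ↑H (FreeMonoid.ofList X) (FreeMonoid.ofList Y) := (Con.eq _).mp h
    have hle : snCon n ↑H ≤ stepCon H := by
      apply Con.conGen_le.mpr
      rintro a b ⟨σ, hσ, rfl, rfl⟩
      exact Relation.ReflTransGen.single ⟨[], [], 1, H.one_mem, σ, hσ, by simp [permWord], by simp [permWord]⟩
    exact hle h1
  · intro h
    induction h with
    | refl => rfl
    | tail _ hs ih =>
      rw [ih]
      obtain ⟨A, B, σ, hσ, τ, hτ, rfl, rfl⟩ := hs
      simp only [cl_append, cl_w hσ, cl_w hτ]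

lemma mem_P (i : Fin n) (X : List (Fin n)) :
    (∃ s t : SnMonoid n ↑H, cl H X = s * (aGen n ↑H i) ^ 2 * t) ↔
      ∃ S T, Eqv H X (S ++ ([i, i] ++ T)) := by
  constructor
  · rintro ⟨s, t, h⟩
    obtain ⟨S, rfl⟩ := cl_surj s
    obtain ⟨T, rfl⟩ := cl_surj t
    refine ⟨S, T, cl_eq.mp ?_⟩
    rw [h, show [i, i] = [i] ++ [i] from rfl]
    simp only [cl_append, cl_gen, pow_two, mul_assoc]
  · rintro ⟨S, T, h⟩
    refine ⟨cl H S, cl H T, ?_⟩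
    rw [cl_eq.mpr h, show [i, i] = [i] ++ [i] from rfl]
    simp only [cl_append, cl_gen, pow_two, mul_assoc]

lemma class_z {σ : Equiv.Perm (Fin n)} (hσ : σ ∈ H) {X : List (Fin n)} (h : Eqv H (w σ) X) :
    ∃ τ ∈ H, X = w τ := by
  induction h with
  | refl => exact ⟨σ, hσ, rfl⟩
  | tail _ hs ih =>
    obtain ⟨τ, hτ, rfl⟩ := ih
    obtain ⟨A, B, σ', hσ', τ', hτ', h, rfl⟩ := hs
    have hl := congrArg List.length h
    simp at hl
    have hA : A = [] := List.length_eq_zero_iff.mp (by omega)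
    have hB : B = [] := List.length_eq_zero_iff.mp (by omega)
    subst hA hB
    exact ⟨τ', hτ', by simp⟩

end SnAux

theorem stmt14 (n : ℕ) (hn : 2 < n) (H : Subgroup (Equiv.Perm (Fin n)))
    (hab : ∀ σ ∈ H, ∀ τ ∈ H, σ * τ = τ * σ)
    (htrans : ∀ i j : Fin n, ∃ σ ∈ H, σ i = j)
    (hrot : finRotate n ∉ H) :
    (∀ i : Fin n, MonoidIdeal.IsPrime
      {x : SnMonoid n ↑H | ∃ s t : SnMonoid n ↑H,
        x = s * (aGen n ↑H i) ^ 2 * t}) ∧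
    ¬ MonoidIdeal.IsPrime
      {x : SnMonoid n ↑H | ∃ i : Fin n, ∃ s t : SnMonoid n ↑H,
        x = s * (aGen n ↑H i) ^ 2 * t} := by
  open SnAux in
  refine ⟨?_, ?_⟩
  · intro i u v hu hv
    obtain ⟨U, rfl⟩ := cl_surj u
    obtain ⟨V, rfl⟩ := cl_surj v
    simp only [Set.mem_ofPred_eq, mem_P] at hu hv ⊢
    obtain ⟨j, hji, hj⟩ := goodR hn hab htrans hrot U i
    obtain ⟨l, hli, hl⟩ := goodL hn hab htrans hrot V i
    refine ⟨cl H [j, j, l, l], ?_⟩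
    rw [← cl_append, ← cl_append, mem_P, List.append_assoc]
    rintro ⟨S, T, h⟩
    obtain ⟨U', V', hU, hV, e⟩ := insulated hn hj hl h
    refine (chain_iff i (U' ++ ([j, j, l, l] ++ V'))).mp ?_ S T e.symm
    have c1 := (chain_iff i U').mpr fun S T e => hu ⟨S, T, e ▸ hU⟩
    have c2 := (chain_iff i V').mpr fun S T e => hv ⟨S, T, e ▸ hV⟩
    rw [List.isChain_append, List.isChain_append]
    refine ⟨c1, ⟨?_, c2, ?_⟩, ?_⟩
    · simp [hji, hli]
    · simp [hli]
    · simp [hji]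
  · intro hp
    have hz : zElem n ↑H ∉ {x : SnMonoid n ↑H | ∃ i : Fin n, ∃ s t : SnMonoid n ↑H,
        x = s * (aGen n ↑H i) ^ 2 * t} := by
      rintro ⟨i, h⟩
      rw [← cl_w H.one_mem, mem_P] at h
      obtain ⟨S, T, h⟩ := h
      obtain ⟨τ, hτ, e⟩ := class_z H.one_mem h
      have := w_nodup τ
      rw [← e] at this
      simp [List.nodup_append] at this
    obtain ⟨s, hs⟩ := hp _ _ hz hz
    apply hs
    obtain ⟨S, rfl⟩ := cl_surj s
    have hne : S ++ w (1 : Equiv.Perm (Fin n)) ≠ [] := by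
      intro h0
      have := congrArg List.length h0
      simp at this
      omega
    obtain ⟨i, R, hR⟩ := List.exists_cons_of_ne_nil hne
    obtain ⟨σ, hσ, hi⟩ := htrans ⟨n - 1, by omega⟩ i
    refine ⟨i, ?_⟩
    rw [mul_assoc]
    nth_rewrite 2 [← cl_w H.one_mem]
    rw [← cl_w hσ, ← cl_append, ← cl_append, mem_P, hR]
    refine ⟨(w σ).dropLast, R, ?_⟩
    have hw : w σ ≠ [] := by
      intro h0
      have := congrArg List.length h0
      simp at this
      omega
    have hlast : (w σ).getLast hw = i := by
      rw [List.getLast_eq_getElem]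
      simp [hi]
    have : w σ ++ i :: R = (w σ).dropLast ++ ([i, i] ++ R) := by
      conv_lhs => rw [← List.dropLast_append_getLast hw, hlast]
      simp
    rw [this]
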